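/- Let Δ ∈ ℕ and let S = {x ∈ ℝⁿ : Ax ≤ b} be a full-dimensional simplex with A ∈ ℤ^{(n+1)×n}, b ∈ ℤ^{n+1}, 1 ≤ Δ_A ≤ Δ, and every facet width of S at least Δ − 1. For each i ∈ {1, …, n+1}, let A_i ∈ ℤ^{n×n} be the matrix obtained from A by deleting its i-th row and b^{(i)} the corresponding subvector of b, let u_i := A_i^{-1}b^{(i)}, and let S_i be the convex hull of {u_i, u_i − (Δ−1)a'_1, …, u_i − (Δ−1)a'_n}, where a'_1, …, a'_n are the columns of A_i^{-1}. Then every vertex (extreme point) of the convex hull of S ∩ ℤⁿ lies in the union S_1 ∪ S_2 ∪ … ∪ S_{n+1}. -/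

import Mathlib

open Matrix

/-- The width of a set `S ⊆ ℝⁿ` in the direction `v`:
`w(v, S) = sup_{x ∈ S} v·x − inf_{x ∈ S} v·x`. -/
noncomputable def width {n : ℕ} (v : Fin n → ℝ) (S : Set (Fin n → ℝ)) : ℝ :=
  sSup ((fun x => v ⬝ᵥ x) '' S) - sInf ((fun x => v ⬝ᵥ x) '' S)

/-- The integer points of `ℝⁿ`. -/
def intPts (n : ℕ) : Set (Fin n → ℝ) := {x | ∀ i, ∃ z : ℤ, x i = (z : ℝ)}

/-- `Δ_A`: the maximum absolute value of an `n × n` subdeterminant of `A ∈ ℤ^{m×n}`. -/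
noncomputable def maxSubdet {m n : ℕ} (A : Matrix (Fin m) (Fin n) ℤ) : ℕ :=
  Finset.univ.sup fun g : Fin n ↪ Fin m => ((A.submatrix g id).det).natAbs

/-- The simplex `conv{u, u − (Δ−1)a'_1, …, u − (Δ−1)a'_n}`, where `u = M⁻¹c` and
`a'_1, …, a'_n` are the columns of `M⁻¹`. -/
noncomputable def cornerSimplex {n : ℕ} (M : Matrix (Fin n) (Fin n) ℝ)
    (c : Fin n → ℝ) (Δ : ℕ) : Set (Fin n → ℝ) :=
  convexHull ℝ ({M⁻¹.mulVec c} ∪ Set.range fun i : Fin n =>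
    M⁻¹.mulVec c - ((Δ : ℝ) - 1) • fun k => M⁻¹ k i)

/-- The lattice generated by the columns of a nonsingular integer matrix `M` has index `|det M|`. -/
theorem natCard_quotient_range_mulVecLin {ι : Type*} [Fintype ι] [DecidableEq ι]
    (M : Matrix ι ι ℤ) (hM : M.det ≠ 0) :
    Nat.card ((ι → ℤ) ⧸ LinearMap.range M.mulVecLin) = M.det.natAbs := by
  have hinj : Function.Injective M.mulVecLin := Matrix.mulVec_injective_of_det_ne_zero hM
  rw [← Submodule.natAbs_det_equiv _ (LinearEquiv.ofInjective M.mulVecLin hinj),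
    ← LinearMap.det_toLin' M]
  rfl

/-- More than `|det M|` integer vectors contain two that differ by an element of the lattice
generated by the columns of `M`. -/
theorem exists_ne_sub_eq_mulVec {ι T : Type*} [Fintype ι] [DecidableEq ι] [Fintype T]
    (M : Matrix ι ι ℤ) (hM : M.det ≠ 0) (f : T → ι → ℤ) (hcard : M.det.natAbs < Fintype.card T) :
    ∃ p q, p ≠ q ∧ ∃ z, M.mulVec z = f p - f q := by
  have hN := natCard_quotient_range_mulVecLin M hM
  have : Finite ((ι → ℤ) ⧸ LinearMap.range M.mulVecLin) :=
    Nat.finite_of_card_ne_zero (by rw [hN]; simpa using hM)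
  have := Fintype.ofFinite ((ι → ℤ) ⧸ LinearMap.range M.mulVecLin)
  rw [← hN, Nat.card_eq_fintype_card] at hcard
  obtain ⟨p, q, hpq, h⟩ := Fintype.exists_ne_map_eq_of_card_lt
    (fun t => Submodule.Quotient.mk (p := LinearMap.range M.mulVecLin) (f t)) hcard
  obtain ⟨z, hz⟩ := (Submodule.Quotient.eq _).1 h
  exact ⟨p, q, hpq, z, hz⟩

/-- If `∑ k, s k ≥ |det M|`, then two of the points `m • e_k` with `0 ≤ m ≤ s k` are congruent
modulo the columns of `M`; their difference is a nonzero lattice vector in the box `[-s, s]` on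
which every functional with nonnegative coefficients `μ` is at most `max k, μ k * s k`. -/
theorem exists_ne_zero_abs_mulVec_le {ι : Type*} [Fintype ι] [DecidableEq ι]
    (M : Matrix ι ι ℤ) (hM : M.det ≠ 0) (s : ι → ℕ) (hs : M.det.natAbs ≤ ∑ k, s k)
    (μ : ι → ℤ) (hμ : ∀ k, 0 ≤ μ k) (K : ℤ) (hK0 : 0 ≤ K) (hK : ∀ k, μ k * s k ≤ K) :
    ∃ z : ι → ℤ, z ≠ 0 ∧ (∀ k, |M.mulVec z k| ≤ s k) ∧ |∑ k, μ k * M.mulVec z k| ≤ K := by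
  let f : Option (Σ k : ι, Fin (s k)) → ι → ℤ := fun t =>
    t.elim 0 fun x => Pi.single x.1 ((x.2 : ℤ) + 1)
  have hf_inj : Function.Injective f := by
    rintro (_ | ⟨k, m⟩) (_ | ⟨l, m'⟩) h
    · rfl
    · have := congrFun h l
      simp [f] at this
      omega
    · have := congrFun h k
      simp [f] at this
      omega
    · have h1 := congrFun h k
      by_cases hkl : k = l
      · subst hkl
        simp only [f, Option.elim, Pi.single_eq_same] at h1
        have : m = m' := by ext; omega
        rw [this]
      · simp [f, hkl] at h1
        omega
  have hf_box : ∀ t k, 0 ≤ f t k ∧ f t k ≤ s k := by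
    rintro (_ | ⟨l, m⟩) k
    · simp [f]
    · by_cases hkl : k = l
      · subst hkl
        have := m.2
        simp only [f, Option.elim, Pi.single_eq_same]
        omega
      · simp [f, hkl]
  have hf_sum : ∀ t, 0 ≤ ∑ k, μ k * f t k ∧ ∑ k, μ k * f t k ≤ K := by
    intro t
    refine ⟨Finset.sum_nonneg fun k _ => mul_nonneg (hμ k) (hf_box t k).1, ?_⟩
    rcases t with (_ | ⟨l, m⟩)
    · simpa [f] using hK0
    · have h1 : ∑ k, μ k * f (some ⟨l, m⟩) k = μ l * ((m : ℤ) + 1) := by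
        simp [f, Pi.single_apply]
      rw [h1]
      have := m.2
      exact (mul_le_mul_of_nonneg_left (by omega) (hμ l)).trans (hK l)
  obtain ⟨p, q, hpq, z, hz⟩ := exists_ne_sub_eq_mulVec M hM f (by simp; omega)
  refine ⟨z, ?_, fun k => ?_, ?_⟩
  · rintro rfl
    exact hpq (hf_inj (sub_eq_zero.1 (by rw [← hz, Matrix.mulVec_zero])))
  · have hp := hf_box p k
    have hq := hf_box q k
    rw [hz, Pi.sub_apply, abs_le]
    omega
  · have hp := hf_sum p
    have hq := hf_sum q
    simp only [hz, Pi.sub_apply, mul_sub, Finset.sum_sub_distrib]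
    rw [abs_le]
    omega

/-- The signed maximal minors of an `(n+1) × n` matrix form a linear relation between its rows. -/
theorem sum_signed_minor_mul_eq_zero {R : Type*} [CommRing R] {n : ℕ}
    (A : Matrix (Fin (n + 1)) (Fin n) R) (j : Fin n) :
    ∑ i : Fin (n + 1), (-1) ^ (i : ℕ) * (A.submatrix i.succAbove id).det * A i j = 0 := by
  have h := Matrix.det_succ_column_zero (Matrix.of fun i => Fin.cons (A i j) (A i))
  rw [Matrix.det_zero_of_column_eq (i := 0) (j := j.succ) (Fin.succ_ne_zero j).symm
    (by simp)] at h
  rw [h]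
  refine Finset.sum_congr rfl fun i _ => ?_
  have : (Matrix.of fun i => (Fin.cons (A i j) (A i) : Fin (n + 1) → R)).submatrix
      i.succAbove Fin.succ = A.submatrix i.succAbove id := by
    ext; simp
  rw [this]
  simp
  ring

/-- If some maximal minor of the `(n+1) × n` matrix `A` is nonzero and `{d | A d ≤ 0}` is trivial,
then all maximal minors are nonzero, and their absolute values form a linear relation between the
rows of `A`. -/
theorem natAbs_minor_relation {n : ℕ} (A : Matrix (Fin (n + 1)) (Fin n) ℤ)
    (hrec : ∀ d : Fin n → ℤ, A.mulVec d ≤ 0 → d = 0)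
    (hdet : ∃ i : Fin (n + 1), (A.submatrix i.succAbove id).det ≠ 0) :
    (∀ i : Fin (n + 1), (A.submatrix i.succAbove id).det ≠ 0) ∧
      ∀ d : Fin n → ℤ,
        ∑ i : Fin (n + 1), ((A.submatrix i.succAbove id).det.natAbs : ℤ) * A.mulVec d i = 0 := by
  obtain ⟨i, hi⟩ := hdet
  set c : Fin (n + 1) → ℤ := fun i => (-1) ^ (i : ℕ) * (A.submatrix i.succAbove id).det with hc
  have hrel : ∀ d : Fin n → ℤ, ∑ i, c i * A.mulVec d i = 0 := by
    intro d
    simp only [Matrix.mulVec, dotProduct, Finset.mul_sum]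
    rw [Finset.sum_comm]
    refine Finset.sum_eq_zero fun j _ => ?_
    simp only [← mul_assoc, ← Finset.sum_mul]
    rw [sum_signed_minor_mul_eq_zero, zero_mul]
  have habs : ∀ k, |c k| = |(A.submatrix k.succAbove id).det| := by simp [hc, abs_mul]
  have hci : c i ≠ 0 := by rw [← abs_ne_zero, habs, abs_ne_zero]; exact hi
  have hpos : ∀ k, 0 < c i * c k := by
    intro k
    rcases Fin.eq_self_or_eq_succAbove i k with rfl | ⟨l, rfl⟩
    · exact mul_self_pos.2 hci
    by_contra! hneg
    set M := A.submatrix i.succAbove id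
    set d := M.adjugate.mulVec (Pi.single l (-M.det)) with hd
    have hMd : M.mulVec d = Pi.single l (-M.det * M.det) := by
      rw [hd, Matrix.mulVec_mulVec, Matrix.mul_adjugate, Matrix.smul_mulVec, Matrix.one_mulVec]
      ext j
      by_cases h : j = l
      · subst h; simp
      · simp [h]
    have hrow : ∀ j, A.mulVec d (i.succAbove j) = M.mulVec d j := fun j => rfl
    have h0 := hrel d
    rw [Fin.sum_univ_succAbove _ i] at h0
    simp only [hrow, hMd, Pi.single_apply, mul_ite, mul_zero, Finset.sum_ite_eq',
      Finset.mem_univ, if_true] at h0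
    have hd0 : d = 0 := by
      refine hrec d fun k => ?_
      rcases Fin.eq_self_or_eq_succAbove i k with rfl | ⟨j, rfl⟩
      · have h1 : 0 < c k * c k := mul_self_pos.2 hci
        have h2 : c k * c k * A.mulVec d k = c k * c (k.succAbove l) * (M.det * M.det) := by
          linear_combination c k * h0
        have h3 : c k * c k * A.mulVec d k ≤ 0 := by
          rw [h2]
          exact mul_nonpos_of_nonpos_of_nonneg hneg (mul_self_nonneg _)
        exact nonpos_of_mul_nonpos_right h3 h1
      · rw [hrow, hMd, Pi.single_apply, Pi.zero_apply]
        split_ifs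
        · rw [neg_mul]; exact neg_nonpos.2 (mul_self_nonneg _)
        · exact le_rfl
    have h1 := congrFun hMd l
    rw [hd0, Matrix.mulVec_zero, Pi.single_eq_same, Pi.zero_apply, neg_mul, zero_eq_neg,
      mul_self_eq_zero] at h1
    exact hi h1
  refine ⟨fun k hk => ?_, fun d => ?_⟩
  · have h1 := hpos k
    simp [hc, hk] at h1
  · have h1 : |c i| * ∑ k, |c k| * A.mulVec d k = c i * ∑ k, c k * A.mulVec d k := by
      simp only [Finset.mul_sum, ← mul_assoc, ← abs_mul, abs_of_pos (hpos _)]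
    rw [hrel, mul_zero] at h1
    simpa [habs, hi] using h1

/-- A nonempty bounded polyhedron `{x | A x ≤ b}` has trivial recession cone. -/
theorem eq_zero_of_mulVec_nonpos_of_isBounded {m n : ℕ} (A : Matrix (Fin m) (Fin n) ℝ)
    (b : Fin m → ℝ) (hbd : Bornology.IsBounded {x | A.mulVec x ≤ b}) {x : Fin n → ℝ}
    (hx : A.mulVec x ≤ b) {d : Fin n → ℝ} (hd : A.mulVec d ≤ 0) : d = 0 := by
  obtain ⟨R, hR⟩ := hbd.exists_norm_le
  by_contra hne
  have hdpos : 0 < ‖d‖ := norm_pos_iff.2 hne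
  have hR0 : 0 ≤ R := (norm_nonneg x).trans (hR x hx)
  set r := (2 * R + 1) / ‖d‖ with hr
  have hr0 : 0 ≤ r := by positivity
  have hmem : A.mulVec (x + r • d) ≤ b := by
    rw [Matrix.mulVec_add, Matrix.mulVec_smul]
    intro k
    have h1 := hx k
    have h2 := mul_nonpos_of_nonneg_of_nonpos hr0 (hd k)
    simp only [Pi.add_apply, Pi.smul_apply, smul_eq_mul]
    linarith
  have h1 : ‖r • d‖ = 2 * R + 1 := by
    rw [norm_smul, Real.norm_of_nonneg hr0, hr, div_mul_cancel₀ _ hdpos.ne']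
  have h2 : ‖r • d‖ ≤ ‖x + r • d‖ + ‖x‖ := by
    simpa using norm_sub_le (x + r • d) x
  linarith [hR _ hmem, hR _ hx]

theorem exists_minor_ne_zero_of_one_le_maxSubdet {n : ℕ} (A : Matrix (Fin (n + 1)) (Fin n) ℤ)
    (h : 1 ≤ maxSubdet A) : ∃ i : Fin (n + 1), (A.submatrix i.succAbove id).det ≠ 0 := by
  obtain ⟨g, -, hg⟩ := (Finset.lt_sup_iff (a := 0)).1 h
  obtain ⟨i, hi⟩ : ∃ i, i ∉ Set.range g := by
    by_contra! hsurj
    have := Fintype.card_le_of_surjective g hsurj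
    simp at this
  have hex : ∀ k, ∃ l, i.succAbove l = g k := fun k =>
    Fin.exists_succAbove_eq fun hk => hi ⟨k, hk⟩
  choose σ hσ using hex
  have hσ_inj : Function.Injective σ := fun a b hab => g.injective (by rw [← hσ, ← hσ, hab])
  let e := Equiv.ofBijective σ hσ_inj.bijective_of_finite
  refine ⟨i, fun h0 => ?_⟩
  have h1 : A.submatrix g id = (A.submatrix i.succAbove id).submatrix e id := by
    ext a b
    simp [e, hσ]
  rw [h1, Matrix.det_permute, h0] at hg
  simp at hg

theorem natAbs_minor_le_maxSubdet {n : ℕ} (A : Matrix (Fin (n + 1)) (Fin n) ℤ)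
    (i : Fin (n + 1)) : (A.submatrix i.succAbove id).det.natAbs ≤ maxSubdet A :=
  Finset.le_sup (f := fun g : Fin n ↪ Fin (n + 1) => ((A.submatrix g id).det).natAbs)
    (Finset.mem_univ i.succAboveEmb)

/-- A point whose slacks with respect to `M x ≤ c` are nonnegative with sum at most `Δ - 1` lies in
the corner simplex. -/
theorem mem_cornerSimplex {n : ℕ} {M : Matrix (Fin n) (Fin n) ℝ} (hM : IsUnit M.det)
    {c : Fin n → ℝ} {Δ : ℕ} {x : Fin n → ℝ} (h0 : ∀ k, 0 ≤ c k - M.mulVec x k)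
    (hsum : ∑ k, (c k - M.mulVec x k) ≤ (Δ : ℝ) - 1) : x ∈ cornerSimplex M c Δ := by
  set s := c - M.mulVec x with hs
  have hs0 : ∀ k, 0 ≤ s k := h0
  set D : ℝ := (Δ : ℝ) - 1
  have hsum' : ∑ k, s k ≤ D := hsum
  have hD0 : 0 ≤ D := (Finset.sum_nonneg fun k _ => hs0 k).trans hsum'
  have hmul : ∀ k, s k / D * D = s k := by
    intro k
    rcases hD0.eq_or_lt with h | h
    · have h1 : s k ≤ ∑ k, s k := Finset.single_le_sum (fun k _ => hs0 k) (Finset.mem_univ k)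
      have h2 := hs0 k
      rw [← h, mul_zero]
      linarith
    · exact div_mul_cancel₀ _ h.ne'
  have hx : x = M⁻¹.mulVec c - M⁻¹.mulVec s := by
    rw [← Matrix.mulVec_sub, hs, sub_sub_cancel, Matrix.mulVec_mulVec, Matrix.nonsing_inv_mul _ hM,
      Matrix.one_mulVec]
  let w : Option (Fin n) → ℝ := fun t => t.elim (1 - ∑ k, s k / D) fun k => s k / D
  let y : Option (Fin n) → Fin n → ℝ := fun t =>
    t.elim (M⁻¹.mulVec c) fun i => M⁻¹.mulVec c - D • fun k => M⁻¹ k i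
  have key : ∑ t, w t • y t ∈ cornerSimplex M c Δ := by
    refine (convex_convexHull ℝ _).sum_mem ?_ ?_ ?_
    · rintro (_ | k) -
      · simp only [w, Option.elim, ← Finset.sum_div, sub_nonneg]
        exact div_le_one_of_le₀ hsum' hD0
      · exact div_nonneg (hs0 k) hD0
    · simp [w, Fintype.sum_option]
    · rintro (_ | k) -
      · exact subset_convexHull ℝ _ (Or.inl rfl)
      · exact subset_convexHull ℝ _ (Or.inr ⟨k, rfl⟩)
  convert key using 1
  rw [hx, Fintype.sum_option]
  simp only [w, y, Option.elim, smul_sub, smul_smul, hmul, Finset.sum_sub_distrib, sub_smul,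
    one_smul, ← Finset.sum_smul]
  have : M⁻¹.mulVec s = ∑ i, s i • fun k => M⁻¹ k i := by
    ext k
    simp [Matrix.mulVec, dotProduct, Finset.sum_apply, mul_comm]
  rw [this]
  abel

/-- A vertex of the convex hull of `X` lies in `X`. -/
theorem mem_of_notMem_convexHull_diff {E : Type*} [AddCommGroup E] [Module ℝ E] {X : Set E} {v : E}
    (hv : v ∈ convexHull ℝ X) (hvert : v ∉ convexHull ℝ (convexHull ℝ X \ {v})) : v ∈ X := by
  by_contra hvX
  have hsub : X ⊆ convexHull ℝ X \ {v} := fun x hx =>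
    ⟨subset_convexHull ℝ X hx, fun h => hvX (h ▸ hx)⟩
  exact hvert (convexHull_mono hsub hv)

/-- A vertex of the convex hull of `X` is not the midpoint of a nondegenerate segment with endpoints
in `X`. -/
theorem eq_zero_of_add_mem_of_sub_mem {E : Type*} [AddCommGroup E] [Module ℝ E] {X : Set E}
    {v d : E} (hvert : v ∉ convexHull ℝ (convexHull ℝ X \ {v})) (hadd : v + d ∈ X)
    (hsub : v - d ∈ X) : d = 0 := by
  by_contra hd
  refine hvert ?_
  have h1 : v + d ∈ convexHull ℝ (convexHull ℝ X \ {v}) :=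
    subset_convexHull ℝ _ ⟨subset_convexHull ℝ _ hadd, by simpa using hd⟩
  have h2 : v - d ∈ convexHull ℝ (convexHull ℝ X \ {v}) :=
    subset_convexHull ℝ _ ⟨subset_convexHull ℝ _ hsub, by simpa using hd⟩
  have h3 := (convex_convexHull ℝ (convexHull ℝ X \ {v})) h1 h2
    (by norm_num : (0 : ℝ) ≤ 1 / 2) (by norm_num : (0 : ℝ) ≤ 1 / 2) (by norm_num)
  convert h3 using 1
  module

theorem map_intCast_mulVec {m n : ℕ} (A : Matrix (Fin m) (Fin n) ℤ) (x : Fin n → ℤ) (k : Fin m) :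
    (A.map (Int.cast : ℤ → ℝ)).mulVec (fun i => (x i : ℝ)) k = (A.mulVec x k : ℤ) := by
  simp [Matrix.mulVec, dotProduct]

/-- Let `S = {x ∈ ℝⁿ : Ax ≤ b}` be a full-dimensional simplex with `A ∈ ℤ^{(n+1)×n}`,
`b ∈ ℤ^{n+1}`, `1 ≤ Δ_A ≤ Δ`, and every facet width at least `Δ − 1`.  For each
`i ∈ {1, …, n+1}` let `A_i, b^{(i)}` be obtained by deleting the `i`-th row, `u_i = A_i⁻¹
b^{(i)}`, and `S_i = conv{u_i, u_i − (Δ−1)a'_1, …, u_i − (Δ−1)a'_n}` where `a'_j` are the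
columns of `A_i⁻¹`.  Then every vertex of the integer hull of `S` lies in `S_1 ∪ … ∪
S_{n+1}`. -/
theorem vertices_of_integer_hull_in_union_of_corner_simplices {n : ℕ} (hn : 1 ≤ n)
    (Δ : ℕ) (A : Matrix (Fin (n + 1)) (Fin n) ℤ) (b : Fin (n + 1) → ℤ)
    (S : Set (Fin n → ℝ))
    (hS : S = {x | (A.map (Int.cast : ℤ → ℝ)).mulVec x ≤ fun i => (b i : ℝ)})
    (hbd : Bornology.IsBounded S) (hint : (interior S).Nonempty)
    (hΔ1 : 1 ≤ maxSubdet A) (hΔ2 : maxSubdet A ≤ Δ)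
    (hwidth : ∀ i : Fin (n + 1), ((Δ : ℝ) - 1) ≤ width ((A.map (Int.cast : ℤ → ℝ)) i) S)
    (v : Fin n → ℝ)
    (hvX : v ∈ convexHull ℝ (S ∩ intPts n))
    (hvert : v ∉ convexHull ℝ (convexHull ℝ (S ∩ intPts n) \ {v})) :
    ∃ i : Fin (n + 1),
      v ∈ cornerSimplex ((A.submatrix i.succAbove id).map (Int.cast : ℤ → ℝ))
            (fun k => (b (i.succAbove k) : ℝ)) Δ := by
  subst hS
  set X := {x | (A.map (Int.cast : ℤ → ℝ)).mulVec x ≤ fun i => (b i : ℝ)} ∩ intPts n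
  obtain ⟨hvS, hvint⟩ := mem_of_notMem_convexHull_diff hvX hvert
  choose x hx using hvint
  obtain rfl : v = fun i => (x i : ℝ) := funext hx
  have memX : ∀ y : Fin n → ℤ, A.mulVec y ≤ b → (fun i => (y i : ℝ)) ∈ X := fun y hy =>
    ⟨fun k => (map_intCast_mulVec A y k).trans_le (Int.cast_le.2 (hy k)), fun i => ⟨y i, rfl⟩⟩
  have hxb : A.mulVec x ≤ b := fun k => 
    Int.cast_le.1 ((map_intCast_mulVec A x k).symm.trans_le (hvS k))
  have hrec : ∀ d : Fin n → ℤ, A.mulVec d ≤ 0 → d = 0 := fun d hd => by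
    have h := eq_zero_of_mulVec_nonpos_of_isBounded _ _ hbd hvS (d := fun i => (d i : ℝ))
      fun k => (map_intCast_mulVec A d k).trans_le (Int.cast_nonpos.2 (hd k))
    exact funext fun i => Int.cast_eq_zero.1 (congrFun h i)
  obtain ⟨hdet, hrel⟩ :=
    natAbs_minor_relation A hrec (exists_minor_ne_zero_of_one_le_maxSubdet A hΔ1)
  set μ : Fin (n + 1) → ℕ := fun i => (A.submatrix i.succAbove id).det.natAbs
  have hslack : ∀ k, ∃ t : ℕ, (t : ℤ) = b k - A.mulVec x k := fun k =>
    ⟨_, Int.toNat_of_nonneg (sub_nonneg.2 (hxb k))⟩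
  choose s hs using hslack
  obtain ⟨i, hi⟩ := Finite.exists_max fun k => μ k * s k
  refine ⟨i, ?_⟩
  set M := A.submatrix i.succAbove id
  have hrow : ∀ (y : Fin n → ℤ) k, M.mulVec y k = A.mulVec y (i.succAbove k) := fun y k => rfl
  have hsR : ∀ k, (b (i.succAbove k) : ℝ) -
      (M.map (Int.cast : ℤ → ℝ)).mulVec (fun i => (x i : ℝ)) k = (s (i.succAbove k) : ℝ) := by
    intro k
    rw [map_intCast_mulVec, hrow]
    exact_mod_cast (hs (i.succAbove k)).symm
  have hunit : IsUnit (M.map (Int.cast : ℤ → ℝ)).det := by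
    rw [isUnit_iff_ne_zero, ← Int.cast_det]
    exact_mod_cast hdet i
  refine mem_cornerSimplex hunit (fun k => by rw [hsR]; positivity) ?_
  simp only [hsR]
  by_contra! hlarge
  have hlarge' : Δ ≤ ∑ k, s (i.succAbove k) := by
    have h : (Δ : ℝ) < (∑ k, s (i.succAbove k) : ℕ) + 1 := by push_cast; linarith
    exact Nat.lt_succ_iff.1 (by exact_mod_cast h)
  obtain ⟨z, hz0, hzbox, hzsum⟩ := exists_ne_zero_abs_mulVec_le M (hdet i)
    (fun k => s (i.succAbove k)) (((natAbs_minor_le_maxSubdet A i).trans hΔ2).trans hlarge')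
    (fun k => (μ (i.succAbove k) : ℤ)) (fun k => by positivity) ((μ i * s i : ℕ) : ℤ)
    (by positivity) (fun k => by exact_mod_cast hi (i.succAbove k))
  have hbox : ∀ k, |A.mulVec z k| ≤ s k := by
    intro k
    rcases Fin.eq_self_or_eq_succAbove i k with rfl | ⟨l, rfl⟩
    · have h0 := hrel z
      rw [Fin.sum_univ_succAbove _ k] at h0
      simp only [hrow] at hzsum
      rw [← abs_neg, ← eq_neg_of_add_eq_zero_left h0, abs_mul, Nat.abs_cast, Nat.cast_mul] at hzsum
      exact le_of_mul_le_mul_left hzsum (by exact_mod_cast Int.natAbs_pos.2 (hdet k))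
    · exact hzbox l
  have hadd := memX (x + z) fun k => by
    obtain ⟨h1, h2⟩ := abs_le.1 (hbox k)
    have h3 := hs k
    rw [Matrix.mulVec_add, Pi.add_apply]
    linarith
  have hsub := memX (x - z) fun k => by
    obtain ⟨h1, h2⟩ := abs_le.1 (hbox k)
    have h3 := hs k
    rw [Matrix.mulVec_sub, Pi.sub_apply]
    linarith
  have hzero : (fun i => (z i : ℝ)) = 0 := eq_zero_of_add_mem_of_sub_mem hvert
    (by convert hadd using 1; ext; simp) (by convert hsub using 1; ext; simp)
  exact hz0 (funext fun k => Int.cast_eq_zero.1 (congrFun hzero k))
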